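/- Under the standing assumptions, for every n ≥ 0 the k-linear maps Φ : (A#_σH)^{⊗(n+1)} → H^{⊗(n+1)}⊗A^{⊗(n+1)} and Ψ : H^{⊗(n+1)}⊗A^{⊗(n+1)} → (A#_σH)^{⊗(n+1)} defined by Φ(a_0⊗g_0,…,a_n⊗g_n) = (g_0⁽²⁾, g_1⁽³⁾,…,g_n^{(n+2)} | S(g_0⁽¹⁾g_1⁽²⁾⋯g_n^{(n+1)})(a_0), S(g_1⁽¹⁾g_2⁽²⁾⋯g_n^{(n)})(a_1),…, S(g_{n−1}⁽¹⁾g_n⁽²⁾)(a_{n−1}), S(g_n⁽¹⁾)(a_n)) and Ψ(g_0,…,g_n | a_0,…,a_n) = ((g_0⁽¹⁾g_1⁽¹⁾⋯g_n⁽¹⁾)(a_0)⊗g_0⁽²⁾, (g_1⁽²⁾⋯g_n⁽²⁾)(a_1)⊗g_1⁽³⁾,…, g_n^{(n+1)}(a_n)⊗g_n^{(n+2)}) are mutually inverse: Ψ∘Φ = id and Φ∘Ψ = id. -/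

import Mathlib

open TensorProduct

noncomputable section

/-! ## Tensor powers, iterated comultiplication and Sweedler representations -/

/-- `Tpow k V n` is the `(n+1)`-fold tensor power `V ⊗ V ⊗ ⋯ ⊗ V` (`n+1` factors),
bundled as an object of `ModuleCat k`. -/
def Tpow (k : Type) [Field k] (V : Type) [AddCommGroup V] [Module k V] : ℕ → ModuleCat k
  | 0 => ModuleCat.of k V
  | n + 1 => ModuleCat.of k (V ⊗[k] (Tpow k V n))

/-- The elementary tensor `f 0 ⊗ f 1 ⊗ ⋯ ⊗ f n` in `Tpow k V n`. -/
def tpow (k : Type) [Field k] (V : Type) [AddCommGroup V] [Module k V] :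
    (n : ℕ) → (Fin (n + 1) → V) → Tpow k V n
  | 0, f => (f 0 : V)
  | n + 1, f => (f 0 ⊗ₜ[k] tpow k V n (fun i => f i.succ) : V ⊗[k] Tpow k V n)

/-- The iterated comultiplication `Δ⁽ⁿ⁾ : H → H^{⊗(n+1)}`, `Δ⁽⁰⁾ = id`,
`Δ⁽ⁿ⁺¹⁾ = (1 ⊗ Δ⁽ⁿ⁾) ∘ Δ`. -/
def comulIter (k : Type) [Field k] (H : Type) [Ring H] [HopfAlgebra k H] :
    (n : ℕ) → H →ₗ[k] Tpow k H n
  | 0 => LinearMap.id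
  | n + 1 =>
    (LinearMap.lTensor H (comulIter k H n) ∘ₗ Coalgebra.comul :
      H →ₗ[k] (H ⊗[k] Tpow k H n))

/-- A finite Sweedler-type representation `Δ⁽ⁿ⁾ h = ∑ᵢ h⁽¹⁾ᵢ ⊗ ⋯ ⊗ h⁽ⁿ⁺¹⁾ᵢ` of the iterated
comultiplication of `h`; `leg i j` is the `(j+1)`-st Sweedler leg of the `i`-th summand. -/
structure IterRepr (k : Type) [Field k] (H : Type) [Ring H] [HopfAlgebra k H]
    (n : ℕ) (h : H) where
  ι : Type
  s : Finset ι
  leg : ι → Fin (n + 1) → H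
  eq : ∑ i ∈ s, tpow k H n (leg i) = comulIter k H n h

/-- Merge an `(n+1)`-tuple to an `n`-tuple, replacing the two entries at positions `i, i+1`
by the single entry `v`. -/
def mergeAt {V : Type} {n : ℕ} (i : Fin n) (x : Fin (n + 1) → V) (v : V) :
    Fin n → V :=
  fun j => if (j : ℕ) < (i : ℕ) then x (Fin.castSucc j) else
    if (j : ℕ) = (i : ℕ) then v else x j.succ

variable (k : Type) [Field k] (H : Type) [Ring H] [HopfAlgebra k H]

/-- `H` is cocommutative. -/
def Cocomm : Prop :=
  ∀ h : H, (TensorProduct.comm k H H) (Coalgebra.comul (R := k) h) = Coalgebra.comul (R := k) h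

variable (A : Type) [Ring A] [Algebra k A]
variable (rho : H →ₗ[k] A →ₗ[k] A)

/-- `rho` is a weak action of `H` on `A`:
`h(ab) = h⁽¹⁾(a)h⁽²⁾(b)`, `h(1) = ε(h)1` and `1(a) = a`. -/
def IsWeakAction : Prop :=
  (∀ (h : H) (a b : A) (R : IterRepr k H 1 h),
      rho h (a * b) = ∑ i ∈ R.s, rho (R.leg i 0) a * rho (R.leg i 1) b) ∧
  (∀ h : H, rho h (1 : A) = Coalgebra.counit (R := k) h • (1 : A)) ∧
  (∀ a : A, rho 1 a = a)

/-- `rho` makes `A` a left `H`-module algebra: a weak action which is an action. -/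
def IsModuleAlgebraAction : Prop :=
  IsWeakAction k H A rho ∧ (∀ (h l : H) (a : A), rho (h * l) a = rho h (rho l a))

variable (sg : H →ₗ[k] H →ₗ[k] k)

/-- Normality for a `k`-valued cocycle: `σ(h,1) = σ(1,h) = ε(h)`. -/
def NormalK : Prop :=
  ∀ h : H, sg h 1 = Coalgebra.counit (R := k) h ∧ sg 1 h = Coalgebra.counit (R := k) h

/-- The cocycle property for a `k`-valued cocycle:
`σ(l⁽¹⁾,m⁽¹⁾)σ(h,l⁽²⁾m⁽²⁾) = σ(h⁽¹⁾,l⁽¹⁾)σ(h⁽²⁾l⁽²⁾,m)`. -/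
def CocycleK : Prop :=
  ∀ (h l m : H) (Rh : IterRepr k H 1 h) (Rl : IterRepr k H 1 l) (Rm : IterRepr k H 1 m),
    ∑ j ∈ Rl.s, ∑ c ∈ Rm.s,
        sg (Rl.leg j 0) (Rm.leg c 0) * sg h (Rl.leg j 1 * Rm.leg c 1) =
      ∑ i ∈ Rh.s, ∑ j ∈ Rl.s,
        sg (Rh.leg i 0) (Rl.leg j 0) * sg (Rh.leg i 1 * Rl.leg j 1) m

/-- The twisted module property for a `k`-valued cocycle:
`h⁽¹⁾(l⁽¹⁾(a))σ(h⁽²⁾,l⁽²⁾) = σ(h⁽¹⁾,l⁽¹⁾)(h⁽²⁾l⁽²⁾)(a)`. -/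
def TwistedModuleK : Prop :=
  ∀ (h l : H) (a : A) (Rh : IterRepr k H 1 h) (Rl : IterRepr k H 1 l),
    ∑ i ∈ Rh.s, ∑ j ∈ Rl.s,
        sg (Rh.leg i 1) (Rl.leg j 1) • rho (Rh.leg i 0) (rho (Rl.leg j 0) a) =
      ∑ i ∈ Rh.s, ∑ j ∈ Rl.s,
        sg (Rh.leg i 0) (Rl.leg j 0) • rho (Rh.leg i 1 * Rl.leg j 1) a

/-- The `k`-valued map `σ`, viewed in the convolution algebra `Hom_k(H ⊗ H, A)` via
`x ⊗ y ↦ σ(x,y)1_A`, is convolution invertible. -/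
def ConvInvertibleK : Prop :=
  ∃ sg' : H →ₗ[k] H →ₗ[k] A,
    ∀ (h l : H) (Rh : IterRepr k H 1 h) (Rl : IterRepr k H 1 l),
      (∑ i ∈ Rh.s, ∑ j ∈ Rl.s,
          (sg (Rh.leg i 0) (Rl.leg j 0) • (1 : A)) * sg' (Rh.leg i 1) (Rl.leg j 1) =
        (Coalgebra.counit (R := k) h * Coalgebra.counit (R := k) l) • (1 : A)) ∧
      (∑ i ∈ Rh.s, ∑ j ∈ Rl.s,
          sg' (Rh.leg i 0) (Rl.leg j 0) * (sg (Rh.leg i 1) (Rl.leg j 1) • (1 : A)) =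
        (Coalgebra.counit (R := k) h * Coalgebra.counit (R := k) l) • (1 : A))

/-- Normality, as an identity in `A`: `σ(h,1) = σ(1,h) = ε(h)1_A`. -/
def NormalKA : Prop :=
  ∀ h : H, sg h 1 • (1 : A) = Coalgebra.counit (R := k) h • (1 : A) ∧
    sg 1 h • (1 : A) = Coalgebra.counit (R := k) h • (1 : A)

/-- The cocycle property, as an identity in `A` (values of `σ` lie in `k·1_A`):
`σ(l⁽¹⁾,m⁽¹⁾)σ(h,l⁽²⁾m⁽²⁾) = σ(h⁽¹⁾,l⁽¹⁾)σ(h⁽²⁾l⁽²⁾,m)`. -/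
def CocycleKA : Prop :=
  ∀ (h l m : H) (Rh : IterRepr k H 1 h) (Rl : IterRepr k H 1 l) (Rm : IterRepr k H 1 m),
    ∑ j ∈ Rl.s, ∑ c ∈ Rm.s,
        (sg (Rl.leg j 0) (Rm.leg c 0) * sg h (Rl.leg j 1 * Rm.leg c 1)) • (1 : A) =
      ∑ i ∈ Rh.s, ∑ j ∈ Rl.s,
        (sg (Rh.leg i 0) (Rl.leg j 0) * sg (Rh.leg i 1 * Rl.leg j 1) m) • (1 : A)

/-! ## The operators of the cylindrical module `A ♮_σ H` -/

/-- Spec of the horizontal face `dᵢ` (`0 ≤ i < P`) on `H^{⊗(P+1)} ⊗ A^{⊗(q+1)}`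
(here `P = p+1`):
`dᵢ(g₀,…,g_P | a₀,…,a_q) = (g₀,…,gᵢ⁽¹⁾g_{i+1}⁽¹⁾,…,g_P | σ(gᵢ⁽²⁾,g_{i+1}⁽²⁾)a₀, a₁,…,a_q)`. -/
def IsHorFace (p q : ℕ) (i : Fin (p + 1))
    (D : ((Tpow k H (p + 1) : Type) ⊗[k] (Tpow k A q : Type)) →ₗ[k]
      ((Tpow k H p : Type) ⊗[k] (Tpow k A q : Type))) : Prop :=
  ∀ (g : Fin (p + 2) → H) (a : Fin (q + 1) → A)
    (R : IterRepr k H 1 (g i.castSucc)) (S : IterRepr k H 1 (g i.succ)),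
    D (tpow k H (p + 1) g ⊗ₜ[k] tpow k A q a) =
      ∑ r ∈ R.s, ∑ s ∈ S.s,
        tpow k H p (mergeAt i g (R.leg r 0 * S.leg s 0)) ⊗ₜ[k]
          tpow k A q (Function.update a 0 (sg (R.leg r 1) (S.leg s 1) • a 0))

/-- Spec of the last horizontal face `d_P` on `H^{⊗(P+1)} ⊗ A^{⊗(q+1)}` (here `P = p+1`):
`d_P(g₀,…,g_P | a₀,…,a_q) = (g_P^{(q+2)}g₀⁽¹⁾, g₁,…,g_{P−1} |
σ(g_P^{(q+3)},g₀⁽²⁾)g_P⁽¹⁾(a₀), g_P⁽²⁾(a₁),…,g_P^{(q+1)}(a_q))`. -/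
def IsLastHorFace (p q : ℕ)
    (D : ((Tpow k H (p + 1) : Type) ⊗[k] (Tpow k A q : Type)) →ₗ[k]
      ((Tpow k H p : Type) ⊗[k] (Tpow k A q : Type))) : Prop :=
  ∀ (g : Fin (p + 2) → H) (a : Fin (q + 1) → A)
    (R : IterRepr k H (q + 2) (g (Fin.last (p + 1)))) (S : IterRepr k H 1 (g 0)),
    D (tpow k H (p + 1) g ⊗ₜ[k] tpow k A q a) =
      ∑ r ∈ R.s, ∑ s ∈ S.s,
        tpow k H p
          (Fin.cases (R.leg r ⟨q + 1, by omega⟩ * S.leg s 0)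
            (fun j : Fin p => g j.succ.castSucc)) ⊗ₜ[k]
        tpow k A q (fun c : Fin (q + 1) =>
          if c = 0 then
            sg (R.leg r ⟨q + 2, by omega⟩) (S.leg s 1) • rho (R.leg r 0) (a 0)
          else rho (R.leg r (Fin.castLE (by omega) c)) (a c))

/-- Spec of the horizontal cyclic operator `t` on `H^{⊗(p+1)} ⊗ A^{⊗(q+1)}`:
`t(g₀,…,g_p | a₀,…,a_q) = (g_p^{(q+2)}, g₀,…,g_{p−1} | g_p⁽¹⁾(a₀),…,g_p^{(q+1)}(a_q))`. -/
def IsCycT (p q : ℕ)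
    (T : ((Tpow k H p : Type) ⊗[k] (Tpow k A q : Type)) →ₗ[k]
      ((Tpow k H p : Type) ⊗[k] (Tpow k A q : Type))) : Prop :=
  ∀ (g : Fin (p + 1) → H) (a : Fin (q + 1) → A)
    (R : IterRepr k H (q + 1) (g (Fin.last p))),
    T (tpow k H p g ⊗ₜ[k] tpow k A q a) =
      ∑ r ∈ R.s,
        tpow k H p (Fin.cases (R.leg r (Fin.last (q + 1))) (fun j : Fin p => g j.castSucc))
          ⊗ₜ[k]
        tpow k A q (fun c : Fin (q + 1) => rho (R.leg r c.castSucc) (a c))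

/-- Spec of the vertical cyclic operator `τ` on `H^{⊗(p+1)} ⊗ A^{⊗(q+1)}`:
`τ(g₀,…,g_p | a₀,…,a_q) = (g₀⁽²⁾,…,g_p⁽²⁾ | S(g₀⁽¹⁾⋯g_p⁽¹⁾)(a_q), a₀,…,a_{q−1})`. -/
def IsCycTau (p q : ℕ)
    (T : ((Tpow k H p : Type) ⊗[k] (Tpow k A q : Type)) →ₗ[k]
      ((Tpow k H p : Type) ⊗[k] (Tpow k A q : Type))) : Prop :=
  ∀ (g : Fin (p + 1) → H) (a : Fin (q + 1) → A)
    (R : ∀ i : Fin (p + 1), IterRepr k H 1 (g i)),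
    T (tpow k H p g ⊗ₜ[k] tpow k A q a) =
      ∑ e ∈ Fintype.piFinset (fun i => (R i).s),
        tpow k H p (fun i => (R i).leg (e i) 1) ⊗ₜ[k]
        tpow k A q
          (Fin.cases
            (rho (HopfAlgebra.antipode (R := k)
                ((List.ofFn (fun i : Fin (p + 1) => (R i).leg (e i) 0)).prod))
              (a (Fin.last q)))
            (fun c : Fin q => a c.castSucc))

/-- Spec of the vertical face `δᵢ` (`0 ≤ i < Q`) on `H^{⊗(p+1)} ⊗ A^{⊗(Q+1)}`
(here `Q = q+1`): `δᵢ(g | a₀,…,a_Q) = (g | a₀,…,aᵢa_{i+1},…,a_Q)`. -/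
def IsVerFace (p q : ℕ) (i : Fin (q + 1))
    (D : ((Tpow k H p : Type) ⊗[k] (Tpow k A (q + 1) : Type)) →ₗ[k]
      ((Tpow k H p : Type) ⊗[k] (Tpow k A q : Type))) : Prop :=
  ∀ (g : Fin (p + 1) → H) (a : Fin (q + 2) → A),
    D (tpow k H p g ⊗ₜ[k] tpow k A (q + 1) a) =
      tpow k H p g ⊗ₜ[k] tpow k A q (mergeAt i a (a i.castSucc * a i.succ))

/-- Spec of the last vertical face `δ_Q` on `H^{⊗(p+1)} ⊗ A^{⊗(Q+1)}` (here `Q = q+1`):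
`δ_Q(g₀,…,g_p | a₀,…,a_Q) = (g₀⁽²⁾,…,g_p⁽²⁾ | S(g₀⁽¹⁾⋯g_p⁽¹⁾)(a_Q)a₀, a₁,…,a_{Q−1})`. -/
def IsLastVerFace (p q : ℕ)
    (D : ((Tpow k H p : Type) ⊗[k] (Tpow k A (q + 1) : Type)) →ₗ[k]
      ((Tpow k H p : Type) ⊗[k] (Tpow k A q : Type))) : Prop :=
  ∀ (g : Fin (p + 1) → H) (a : Fin (q + 2) → A)
    (R : ∀ i : Fin (p + 1), IterRepr k H 1 (g i)),
    D (tpow k H p g ⊗ₜ[k] tpow k A (q + 1) a) =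
      ∑ e ∈ Fintype.piFinset (fun i => (R i).s),
        tpow k H p (fun i => (R i).leg (e i) 1) ⊗ₜ[k]
        tpow k A q
          (Fin.cases
            (rho (HopfAlgebra.antipode (R := k)
                ((List.ofFn (fun i : Fin (p + 1) => (R i).leg (e i) 0)).prod))
              (a (Fin.last (q + 1))) * a 0)
            (fun c : Fin q => a c.succ.castSucc))

/-! ## The crossed product `A #_σ H`, its cyclic module, and the maps `Φ`, `Ψ` -/

/-- Spec of the multiplication of the crossed product `A #_σ H` on `A ⊗ H`:
`(a ⊗ h)(b ⊗ l) = a h⁽¹⁾(b) σ(h⁽²⁾,l⁽¹⁾) ⊗ h⁽³⁾l⁽²⁾`. -/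
def IsCrossedMul (mul : (A ⊗[k] H) →ₗ[k] (A ⊗[k] H) →ₗ[k] (A ⊗[k] H)) : Prop :=
  ∀ (a b : A) (h l : H) (R : IterRepr k H 2 h) (S : IterRepr k H 1 l),
    mul (a ⊗ₜ[k] h) (b ⊗ₜ[k] l) =
      ∑ i ∈ R.s, ∑ j ∈ S.s,
        (sg (R.leg i 1) (S.leg j 0) • (a * rho (R.leg i 0) b)) ⊗ₜ[k]
          (R.leg i 2 * S.leg j 1)

/-- Spec of the map `Φ : (A #_σ H)^{⊗(n+1)} → H^{⊗(n+1)} ⊗ A^{⊗(n+1)}`: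
`Φ(a₀ ⊗ g₀,…,aₙ ⊗ gₙ) = (g₀⁽²⁾, g₁⁽³⁾,…,gₙ⁽ⁿ⁺²⁾ | S(g₀⁽¹⁾g₁⁽²⁾⋯gₙ⁽ⁿ⁺¹⁾)(a₀),…,S(gₙ⁽¹⁾)(aₙ))`. -/
def IsPhi (n : ℕ)
    (Phi : (Tpow k (A ⊗[k] H) n : Type) →ₗ[k]
      ((Tpow k H n : Type) ⊗[k] (Tpow k A n : Type))) : Prop :=
  ∀ (a : Fin (n + 1) → A) (g : Fin (n + 1) → H)
    (R : ∀ i : Fin (n + 1), IterRepr k H ((i : ℕ) + 1) (g i)),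
    Phi (tpow k (A ⊗[k] H) n (fun i => a i ⊗ₜ[k] g i)) =
      ∑ e ∈ Fintype.piFinset (fun i => (R i).s),
        tpow k H n (fun i => (R i).leg (e i) (Fin.last ((i : ℕ) + 1))) ⊗ₜ[k]
        tpow k A n (fun i =>
          rho (HopfAlgebra.antipode (R := k)
              ((List.ofFn (fun m : Fin (n + 1 - (i : ℕ)) =>
                (R ⟨(i : ℕ) + (m : ℕ), by have := m.isLt; have := i.isLt; omega⟩).leg
                  (e ⟨(i : ℕ) + (m : ℕ), by have := m.isLt; have := i.isLt; omega⟩)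
                  ⟨(m : ℕ), by have := m.isLt; have := i.isLt; simp; omega⟩)).prod))
            (a i))

/-- Spec of the map `Ψ : H^{⊗(n+1)} ⊗ A^{⊗(n+1)} → (A #_σ H)^{⊗(n+1)}`:
`Ψ(g₀,…,gₙ | a₀,…,aₙ) = ((g₀⁽¹⁾⋯gₙ⁽¹⁾)(a₀) ⊗ g₀⁽²⁾,…, gₙ⁽ⁿ⁺¹⁾(aₙ) ⊗ gₙ⁽ⁿ⁺²⁾)`. -/
def IsPsi (n : ℕ)
    (Psi : ((Tpow k H n : Type) ⊗[k] (Tpow k A n : Type)) →ₗ[k]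
      (Tpow k (A ⊗[k] H) n : Type)) : Prop :=
  ∀ (g : Fin (n + 1) → H) (a : Fin (n + 1) → A)
    (R : ∀ i : Fin (n + 1), IterRepr k H ((i : ℕ) + 1) (g i)),
    Psi (tpow k H n g ⊗ₜ[k] tpow k A n a) =
      ∑ e ∈ Fintype.piFinset (fun i => (R i).s),
        tpow k (A ⊗[k] H) n (fun i =>
          (rho ((List.ofFn (fun m : Fin (n + 1 - (i : ℕ)) =>
                (R ⟨(i : ℕ) + (m : ℕ), by have := m.isLt; have := i.isLt; omega⟩).leg
                  (e ⟨(i : ℕ) + (m : ℕ), by have := m.isLt; have := i.isLt; omega⟩)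
                  ⟨(i : ℕ), by have := m.isLt; have := i.isLt; simp; omega⟩)).prod)
            (a i)) ⊗ₜ[k]
          (R i).leg (e i) (Fin.last ((i : ℕ) + 1)))

/-- Spec of the cyclic operator of the cyclic module of an algebra, on `X^{⊗(n+1)}`:
`τ(x₀ ⊗ ⋯ ⊗ xₙ) = xₙ ⊗ x₀ ⊗ ⋯ ⊗ x_{n−1}`. -/
def IsAlgCyc (X : Type) [AddCommGroup X] [Module k X] (n : ℕ)
    (C : (Tpow k X n : Type) →ₗ[k] (Tpow k X n : Type)) : Prop :=
  ∀ x : Fin (n + 1) → X,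
    C (tpow k X n x) =
      tpow k X n (Fin.cases (x (Fin.last n)) (fun j : Fin n => x j.castSucc))

/-- Spec of the face `δᵢ` (`0 ≤ i < n+1`) of the cyclic module of the algebra
`(A ⊗ H, mul)`: `δᵢ(x₀ ⊗ ⋯ ⊗ x_{n+1}) = x₀ ⊗ ⋯ ⊗ xᵢx_{i+1} ⊗ ⋯ ⊗ x_{n+1}`. -/
def IsAlgFace (mul : (A ⊗[k] H) →ₗ[k] (A ⊗[k] H) →ₗ[k] (A ⊗[k] H)) (n : ℕ) (i : Fin (n + 1))
    (D : (Tpow k (A ⊗[k] H) (n + 1) : Type) →ₗ[k] (Tpow k (A ⊗[k] H) n : Type)) : Prop :=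
  ∀ x : Fin (n + 2) → A ⊗[k] H,
    D (tpow k (A ⊗[k] H) (n + 1) x) =
      tpow k (A ⊗[k] H) n (mergeAt i x (mul (x i.castSucc) (x i.succ)))

/-- Spec of the last face `δ_{n+1}` of the cyclic module of the algebra `(A ⊗ H, mul)`:
`δ_{n+1}(x₀ ⊗ ⋯ ⊗ x_{n+1}) = x_{n+1}x₀ ⊗ x₁ ⊗ ⋯ ⊗ xₙ`. -/
def IsAlgLastFace (mul : (A ⊗[k] H) →ₗ[k] (A ⊗[k] H) →ₗ[k] (A ⊗[k] H)) (n : ℕ)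
    (D : (Tpow k (A ⊗[k] H) (n + 1) : Type) →ₗ[k] (Tpow k (A ⊗[k] H) n : Type)) : Prop :=
  ∀ x : Fin (n + 2) → A ⊗[k] H,
    D (tpow k (A ⊗[k] H) (n + 1) x) =
      tpow k (A ⊗[k] H) n
        (Fin.cases (mul (x (Fin.last (n + 1))) (x 0)) (fun j : Fin n => x j.succ.castSucc))

section TensorPowers

variable {k : Type} [Field k] {V : Type} [AddCommGroup V] [Module k V]

variable (k V) in
/-- The one-fold tensor power is the space itself. -/
def tpowZero : V ≃ₗ[k] (Tpow k V 0 : Type) :=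
  LinearEquiv.refl k V

variable (k V) in
/-- Splitting off the first factor of a tensor power. -/
def tpowCons (n : ℕ) : (V ⊗[k] (Tpow k V n : Type)) ≃ₗ[k] (Tpow k V (n + 1) : Type) :=
  LinearEquiv.refl k (V ⊗[k] (Tpow k V n : Type))

lemma tpow_zero (f : Fin 1 → V) : tpow k V 0 f = tpowZero k V (f 0) := rfl

lemma tpow_succ (n : ℕ) (f : Fin (n + 2) → V) :
    tpow k V (n + 1) f = tpowCons k V n (f 0 ⊗ₜ[k] tpow k V n (fun i => f i.succ)) := rfl

/-- Linear maps out of a tensor power agree if they agree on elementary tensors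
of elements of a spanning set. -/
lemma Tpow.linearMap_ext {W : Type} [AddCommGroup W] [Module k W] {S : Set V}
    (hS : Submodule.span k S = ⊤) (n : ℕ) {L L' : (Tpow k V n : Type) →ₗ[k] W}
    (h : ∀ f : Fin (n + 1) → V, (∀ i, f i ∈ S) → L (tpow k V n f) = L' (tpow k V n f)) :
    L = L' := by
  induction n with
  | zero =>
    have : L ∘ₗ (tpowZero k V).toLinearMap = L' ∘ₗ (tpowZero k V).toLinearMap :=
      LinearMap.ext_on hS fun v hv => h (fun _ => v) fun _ => hv
    refine LinearMap.ext fun x => ?_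
    obtain ⟨y, rfl⟩ := (tpowZero k V).surjective x
    exact LinearMap.congr_fun this y
  | succ n ih =>
    have : L ∘ₗ (tpowCons k V n).toLinearMap = L' ∘ₗ (tpowCons k V n).toLinearMap := by
      refine TensorProduct.ext (LinearMap.ext_on hS fun v hv => ih fun f hf => ?_)
      refine h (Fin.cons v f) fun i => ?_
      refine Fin.cases hv (fun i => ?_) i
      simpa using hf i
    refine LinearMap.ext fun x => ?_
    obtain ⟨y, rfl⟩ := (tpowCons k V n).surjective x
    exact LinearMap.congr_fun this y

end TensorPowers

section Twist

variable {k : Type} [Field k] {H : Type} [Ring H] [HopfAlgebra k H]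
variable {A : Type} [AddCommGroup A] [Module k A]
variable {T : Type} [AddCommGroup T] [Module k T]

/-- `δ` is a counital and coassociative left coaction of `H` on `T`. -/
structure IsCoaction (δ : T →ₗ[k] H ⊗[k] T) : Prop where
  coassoc : ∀ t, TensorProduct.assoc k H H T
    (LinearMap.rTensor T (Coalgebra.comul (R := k)) (δ t)) = LinearMap.lTensor H δ (δ t)
  counit : ∀ t, TensorProduct.lid k T
    (LinearMap.rTensor T (Coalgebra.counit (R := k)) (δ t)) = t

/-- The map `a, h ⊗ t ↦ t ⊗ f h a`. -/
def twistAux (T : Type) [AddCommGroup T] [Module k T] (f : H →ₗ[k] A →ₗ[k] A) :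
    A →ₗ[k] (H ⊗[k] T) →ₗ[k] (T ⊗[k] A) :=
  (LinearMap.rTensorHom T ∘ₗ f.flip).compr₂ (TensorProduct.comm k A T).toLinearMap

@[simp]
lemma twistAux_tmul (f : H →ₗ[k] A →ₗ[k] A) (a : A) (h : H) (t : T) :
    twistAux T f a (h ⊗ₜ[k] t) = t ⊗ₜ[k] f h a := by
  simp [twistAux]

/-- The map `t ⊗ a ↦ t⁽⁰⁾ ⊗ f t⁽⁻¹⁾ a`. -/
def twist (δ : T →ₗ[k] H ⊗[k] T) (f : H →ₗ[k] A →ₗ[k] A) : T ⊗[k] A →ₗ[k] T ⊗[k] A :=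
  TensorProduct.lift ((twistAux T f).flip ∘ₗ δ)

lemma twist_tmul (δ : T →ₗ[k] H ⊗[k] T) (f : H →ₗ[k] A →ₗ[k] A) (t : T) (a : A) :
    twist δ f (t ⊗ₜ[k] a) = twistAux T f a (δ t) := by
  simp [twist]

lemma twist_comp_twist {δ : T →ₗ[k] H ⊗[k] T} (hδ : IsCoaction δ) {f f' : H →ₗ[k] A →ₗ[k] A}
    (hf : ∀ a h, TensorProduct.lift (f.flip ∘ₗ f'.flip a) (Coalgebra.comul (R := k) h) =
      Coalgebra.counit (R := k) h • a) :
    twist δ f ∘ₗ twist δ f' = LinearMap.id := by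
  ext t a
  have h₁ : ∀ z : H ⊗[k] T, twist δ f (twistAux T f' a z) =
      TensorProduct.lift (twistAux T f ∘ₗ f'.flip a) (LinearMap.lTensor H δ z) := by
    intro z
    induction z with
    | zero => simp
    | add x y hx hy => simp only [map_add, hx, hy]
    | tmul h t => simp [twist_tmul]
  have h₂ : ∀ (t : T) (w : H ⊗[k] H), TensorProduct.lift (twistAux T f ∘ₗ f'.flip a)
        (TensorProduct.assoc k H H T (w ⊗ₜ[k] t)) =
      t ⊗ₜ[k] TensorProduct.lift (f.flip ∘ₗ f'.flip a) w := by
    intro t w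
    induction w with
    | zero => simp
    | add x y hx hy => simp only [map_add, hx, hy, TensorProduct.add_tmul, TensorProduct.tmul_add]
    | tmul h t => simp
  have h₃ : ∀ z : H ⊗[k] T, TensorProduct.lift (twistAux T f ∘ₗ f'.flip a)
        (TensorProduct.assoc k H H T (LinearMap.rTensor T (Coalgebra.comul (R := k)) z)) =
      TensorProduct.lid k T (LinearMap.rTensor T (Coalgebra.counit (R := k)) z) ⊗ₜ[k] a := by
    intro z
    induction z with
    | zero => simp
    | add x y hx hy => simp only [map_add, hx, hy, TensorProduct.add_tmul]
    | tmul h t => simp [h₂, hf, TensorProduct.smul_tmul]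
  simp only [TensorProduct.AlgebraTensorModule.curry_apply, LinearMap.restrictScalars_self,
    TensorProduct.curry_apply, LinearMap.comp_apply, LinearMap.id_apply, twist_tmul, h₁,
    ← hδ.coassoc, h₃, hδ.counit]

/-- The map `t ⊗ a ↦ t⁽⁰⁾ ⊗ f t⁽⁻¹⁾ a`, for `f` convolution invertible. -/
def twistEquiv {δ : T →ₗ[k] H ⊗[k] T} (hδ : IsCoaction δ) {f f' : H →ₗ[k] A →ₗ[k] A}
    (hf : ∀ a h, TensorProduct.lift (f.flip ∘ₗ f'.flip a) (Coalgebra.comul (R := k) h) =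
      Coalgebra.counit (R := k) h • a)
    (hf' : ∀ a h, TensorProduct.lift (f'.flip ∘ₗ f.flip a) (Coalgebra.comul (R := k) h) =
      Coalgebra.counit (R := k) h • a) : (T ⊗[k] A) ≃ₗ[k] (T ⊗[k] A) :=
  LinearEquiv.ofLinearMap (twist δ f) (twist δ f') (twist_comp_twist hδ hf) (twist_comp_twist hδ hf')

/-- The diagonal coaction `h ⊗ t ↦ h⁽¹⁾ t⁽⁻¹⁾ ⊗ (h⁽²⁾ ⊗ t⁽⁰⁾)` on `H ⊗ T`. -/
def diagCoact (δ : T →ₗ[k] H ⊗[k] T) : H ⊗[k] T →ₗ[k] H ⊗[k] (H ⊗[k] T) :=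
  LinearMap.rTensor (H ⊗[k] T) (LinearMap.mul' k H) ∘ₗ
    (TensorProduct.tensorTensorTensorComm k H H H T).toLinearMap ∘ₗ
      TensorProduct.map (Coalgebra.comul (R := k)) δ

lemma IsCoaction.comul : IsCoaction (Coalgebra.comul (R := k) (A := H)) where
  coassoc := Coalgebra.coassoc_apply
  counit t := by simp

lemma IsCoaction.diag {δ : T →ₗ[k] H ⊗[k] T} (hδ : IsCoaction δ) : IsCoaction (diagCoact δ) where
  coassoc := by
    let D : (H ⊗[k] H) ⊗[k] (H ⊗[k] T) →ₗ[k] H ⊗[k] (H ⊗[k] T) :=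
      LinearMap.rTensor (H ⊗[k] T) (LinearMap.mul' k H) ∘ₗ
        (TensorProduct.tensorTensorTensorComm k H H H T).toLinearMap
    let Q : (H ⊗[k] (H ⊗[k] H)) ⊗[k] (H ⊗[k] (H ⊗[k] T)) →ₗ[k] H ⊗[k] (H ⊗[k] (H ⊗[k] T)) :=
      TensorProduct.map (LinearMap.mul' k H) D ∘ₗ
        (TensorProduct.tensorTensorTensorComm k H (H ⊗[k] H) H (H ⊗[k] T)).toLinearMap
    have hDt : ∀ h t, diagCoact δ (h ⊗ₜ t) = D (Coalgebra.comul h ⊗ₜ δ t) := fun h t => rfl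
    have h₁ : ∀ (x : H ⊗[k] H) (y : H ⊗[k] T),
        LinearMap.lTensor H (diagCoact δ) (D (x ⊗ₜ y)) =
          Q (LinearMap.lTensor H Coalgebra.comul x ⊗ₜ LinearMap.lTensor H δ y) := by
      intro x y
      induction x with
      | zero => simp
      | add x x' hx hx' => simp only [map_add, TensorProduct.add_tmul, hx, hx']
      | tmul a b =>
        induction y with
        | zero => simp
        | add x x' hx hx' => simp only [map_add, TensorProduct.tmul_add, hx, hx']
        | tmul c t => simp [D, Q, diagCoact]
    have h₃ : ∀ (c e : H ⊗[k] H) (b : H) (t : T),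
        TensorProduct.assoc k H H (H ⊗[k] T) ((c * e) ⊗ₜ (b ⊗ₜ t)) =
          Q (TensorProduct.assoc k H H H (c ⊗ₜ b) ⊗ₜ TensorProduct.assoc k H H T (e ⊗ₜ t)) := by
      intro c e b t
      induction c with
      | zero => simp
      | add x x' hx hx' => simp only [map_add, TensorProduct.add_tmul, add_mul, hx, hx']
      | tmul a b =>
        induction e with
        | zero => simp
        | add x x' hx hx' =>
          simp only [map_add, TensorProduct.add_tmul, TensorProduct.tmul_add, mul_add, hx, hx']
        | tmul c t => simp [D, Q]
    have h₂ : ∀ (x : H ⊗[k] H) (y : H ⊗[k] T),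
        TensorProduct.assoc k H H (H ⊗[k] T)
          (LinearMap.rTensor (H ⊗[k] T) Coalgebra.comul (D (x ⊗ₜ y))) =
        Q (TensorProduct.assoc k H H H (LinearMap.rTensor H Coalgebra.comul x) ⊗ₜ
            TensorProduct.assoc k H H T (LinearMap.rTensor T Coalgebra.comul y)) := by
      intro x y
      induction x with
      | zero => simp
      | add x x' hx hx' => simp only [map_add, TensorProduct.add_tmul, hx, hx']
      | tmul a b =>
        induction y with
        | zero => simp
        | add x x' hx hx' => simp only [map_add, TensorProduct.tmul_add, hx, hx']
        | tmul c t =>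
          have : D ((a ⊗ₜ b) ⊗ₜ (c ⊗ₜ t)) = (a * c) ⊗ₜ (b ⊗ₜ t) := by simp [D]
          rw [this]
          simp only [LinearMap.rTensor_tmul, Bialgebra.comul_mul, h₃]
    intro z
    induction z with
    | zero => simp
    | add x y hx hy => simp only [map_add, hx, hy]
    | tmul h t => rw [hDt, h₁, h₂, hδ.coassoc, Coalgebra.coassoc_apply]
  counit := by
    have h₁ : ∀ (x : H ⊗[k] H) (y : H ⊗[k] T),
        TensorProduct.lid k (H ⊗[k] T) (LinearMap.rTensor (H ⊗[k] T) (Coalgebra.counit (R := k))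
          (LinearMap.rTensor (H ⊗[k] T) (LinearMap.mul' k H)
            (TensorProduct.tensorTensorTensorComm k H H H T (x ⊗ₜ y)))) =
        TensorProduct.lid k H (LinearMap.rTensor H (Coalgebra.counit (R := k)) x) ⊗ₜ
          TensorProduct.lid k T (LinearMap.rTensor T (Coalgebra.counit (R := k)) y) := by
      intro x y
      induction x with
      | zero => simp
      | add x x' hx hx' => simp only [map_add, TensorProduct.add_tmul, hx, hx']
      | tmul a b =>
        induction y with
        | zero => simp
        | add x x' hx hx' => simp only [map_add, TensorProduct.tmul_add, hx, hx']
        | tmul c t => simp [TensorProduct.smul_tmul', TensorProduct.tmul_smul, smul_smul,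
            mul_comm]
    intro z
    induction z with
    | zero => simp
    | add x y hx hy => simp only [map_add, hx, hy]
    | tmul h t =>
      refine (h₁ _ _).trans ?_
      rw [hδ.counit]
      simp

/-- Transport of a coaction along a linear equivalence. -/
lemma IsCoaction.congr {δ : T →ₗ[k] H ⊗[k] T} (hδ : IsCoaction δ) {U : Type} [AddCommGroup U]
    [Module k U] (e : T ≃ₗ[k] U) :
    IsCoaction (LinearMap.lTensor H e.toLinearMap ∘ₗ δ ∘ₗ e.symm.toLinearMap) where
  coassoc u := by
    have h₁ : ∀ z : H ⊗[k] T, LinearMap.lTensor H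
        (LinearMap.lTensor H e.toLinearMap ∘ₗ δ ∘ₗ e.symm.toLinearMap)
        (LinearMap.lTensor H e.toLinearMap z) =
        LinearMap.lTensor H (LinearMap.lTensor H e.toLinearMap) (LinearMap.lTensor H δ z) := by
      intro z
      induction z with
      | zero => simp
      | add x y hx hy => simp only [map_add, hx, hy]
      | tmul h t => simp
    have h₃ : ∀ (c : H ⊗[k] H) (t : T), TensorProduct.assoc k H H U (c ⊗ₜ e t) =
        LinearMap.lTensor H (LinearMap.lTensor H e.toLinearMap)
          (TensorProduct.assoc k H H T (c ⊗ₜ t)) := by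
      intro c t
      induction c with
      | zero => simp
      | add x y hx hy => simp only [map_add, TensorProduct.add_tmul, hx, hy]
      | tmul h t => simp
    have h₂ : ∀ z : H ⊗[k] T, TensorProduct.assoc k H H U
        (LinearMap.rTensor U Coalgebra.comul (LinearMap.lTensor H e.toLinearMap z)) =
        LinearMap.lTensor H (LinearMap.lTensor H e.toLinearMap)
          (TensorProduct.assoc k H H T (LinearMap.rTensor T Coalgebra.comul z)) := by
      intro z
      induction z with
      | zero => simp
      | add x y hx hy => simp only [map_add, hx, hy]
      | tmul h t => simp [h₃]
    simp only [LinearMap.comp_apply] at h₁ ⊢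
    rw [h₂, hδ.coassoc, ← h₁]
  counit u := by
    have h₁ : ∀ z : H ⊗[k] T, TensorProduct.lid k U (LinearMap.rTensor U (Coalgebra.counit (R := k))
        (LinearMap.lTensor H e.toLinearMap z)) =
        e (TensorProduct.lid k T (LinearMap.rTensor T (Coalgebra.counit (R := k)) z)) := by
      intro z
      induction z with
      | zero => simp
      | add x y hx hy => simp only [map_add, hx, hy]
      | tmul h t => simp
    simp [h₁, hδ.counit]

end Twist

section FiniteSums

open Finset

lemma sum_piFinset_sigma {I M : Type} [Fintype I] [DecidableEq I] [AddCommMonoid M]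
    {α : I → Type} {β : ∀ i, α i → Type} (s : ∀ i, Finset (α i)) (t : ∀ i a, Finset (β i a))
    (f : (∀ i, Σ a, β i a) → M) :
    ∑ e ∈ Fintype.piFinset (fun i => (s i).sigma (t i)), f e =
      ∑ u ∈ Fintype.piFinset s, ∑ v ∈ Fintype.piFinset (fun i => t i (u i)),
        f (fun i => ⟨u i, v i⟩) := by
  rw [Finset.sum_sigma']
  refine Finset.sum_bij' (fun e _ => ⟨fun i => (e i).1, fun i => (e i).2⟩)
    (fun p _ i => ⟨p.1 i, p.2 i⟩) ?_ ?_ ?_ ?_ ?_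
  · intro e he
    simp only [Fintype.mem_piFinset, mem_sigma] at he ⊢
    exact ⟨fun i => (he i).1, fun i => (he i).2⟩
  · intro p hp
    simp only [Fintype.mem_piFinset, mem_sigma] at hp ⊢
    exact fun i => ⟨hp.1 i, hp.2 i⟩
  · intro e _; rfl
  · intro p _; rfl
  · intro e _; rfl

lemma sum_piFinset_succ {M : Type} [AddCommMonoid M] {n : ℕ} {α : Fin (n + 1) → Type}
    (s : ∀ i, Finset (α i)) (f : (∀ i, α i) → M) :
    ∑ e ∈ Fintype.piFinset s, f e =
      ∑ a ∈ s 0, ∑ e ∈ Fintype.piFinset (fun i : Fin n => s i.succ), f (Fin.cons a e) := by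
  rw [Finset.sum_sigma']
  refine Finset.sum_bij' (fun e _ => ⟨e 0, fun i => e i.succ⟩)
    (fun p _ => Fin.cons p.1 p.2) ?_ ?_ ?_ ?_ ?_
  · intro e he
    simp only [Fintype.mem_piFinset, mem_sigma] at he ⊢
    exact ⟨he 0, fun i => he i.succ⟩
  · intro p hp
    simp only [Fintype.mem_piFinset, mem_sigma] at hp ⊢
    exact Fin.cases hp.1 hp.2
  · intro e _; exact Fin.cons_self_tail e
  · intro p _; simp
  · intro e _; exact congrArg f (Fin.cons_self_tail e).symm

lemma ofFn_eq_ofFn {α : Type} {m m' : ℕ} (h : m = m') {f : Fin m → α} {f' : Fin m' → α}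
    (hf : ∀ (j : ℕ) (hj : j < m) (hj' : j < m'), f ⟨j, hj⟩ = f' ⟨j, hj'⟩) :
    List.ofFn f = List.ofFn f' := by
  subst h
  exact congrArg List.ofFn (funext fun j => hf j j.2 j.2)

lemma leg_congr {α : Type} {n : ℕ} (x : ∀ i : Fin n, Fin ((i : ℕ) + 2) → α) {i i' : Fin n}
    (hi : i = i') {j : Fin ((i : ℕ) + 2)} {j' : Fin ((i' : ℕ) + 2)} (hj : (j : ℕ) = j') :
    x i j = x i' j' := by
  subst hi
  exact congrArg (x i) (Fin.ext hj)

end FiniteSums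

section Sweedler

variable (k : Type) [Field k] {H : Type} [Ring H] [HopfAlgebra k H]

/-- A finite set of pairs representing the comultiplication of `h`. -/
def comulPairs (h : H) : Finset (H × H) :=
  (Coalgebra.Repr.arbitrary k h).index

lemma sum_comulPairs (h : H) :
    ∑ p ∈ comulPairs k h, p.1 ⊗ₜ[k] p.2 = Coalgebra.comul (R := k) h :=
  (Coalgebra.Repr.arbitrary k h).eq

variable {k} in
lemma IterRepr.sum_pair {h : H} (R : IterRepr k H 1 h) :
    ∑ i ∈ R.s, R.leg i 0 ⊗ₜ[k] R.leg i 1 = Coalgebra.comul (R := k) h := by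
  have : ∑ i ∈ R.s, R.leg i 0 ⊗ₜ[k] R.leg i 1 =
      LinearMap.lTensor H LinearMap.id (Coalgebra.comul (R := k) h) := R.eq
  rw [this, LinearMap.lTensor_id, LinearMap.id_apply]

variable (H) in
lemma comulIter_zero : comulIter k H 0 = (tpowZero k H).toLinearMap := rfl

lemma comulIter_succ (n : ℕ) (h : H) : comulIter k H (n + 1) h =
    tpowCons k H n (LinearMap.lTensor H (comulIter k H n) (Coalgebra.comul (R := k) h)) := rfl

/-- Sweedler representations of `Δ⁽ⁿ⁺¹⁾` obtained by applying `Δ` first and then `Δ⁽ⁿ⁾` to the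
second leg. -/
def frontRepr : (n : ℕ) → (h : H) → IterRepr k H n h
  | 0, h => ⟨Unit, Finset.univ, fun _ _ => h, by simp [tpow_zero, comulIter_zero]⟩
  | n + 1, h =>
    { ι := Σ p : H × H, (frontRepr n p.2).ι
      s := (comulPairs k h).sigma fun p => (frontRepr n p.2).s
      leg := fun e => Fin.cons e.1.1 ((frontRepr n e.1.2).leg e.2)
      eq := by
        simp only [Finset.sum_sigma, tpow_succ, Fin.cons_zero, Fin.cons_succ, comulIter_succ,
          ← map_sum, ← TensorProduct.tmul_sum, (frontRepr n _).eq, ← sum_comulPairs k h]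
        simp only [map_sum, LinearMap.lTensor_tmul] }

/-- Replace the last entry of a tuple by the two entries of a pair. -/
def splitLast {V : Type} (n : ℕ) (f : Fin (n + 1) → V) (p : V × V) : Fin (n + 2) → V :=
  fun j => if h : (j : ℕ) < n then f ⟨j, by omega⟩ else if (j : ℕ) = n then p.1 else p.2

variable (H) in
/-- Comultiplication of the last tensor factor. -/
def comulLast : (n : ℕ) → (Tpow k H n : Type) →ₗ[k] (Tpow k H (n + 1) : Type)
  | 0 => comulIter k H 1 ∘ₗ (tpowZero k H).symm.toLinearMap
  | n + 1 => (tpowCons k H (n + 1)).toLinearMap ∘ₗ LinearMap.lTensor H (comulLast n) ∘ₗ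
      (tpowCons k H n).symm.toLinearMap

lemma comulLast_comulIter (n : ℕ) (h : H) :
    comulLast k H n (comulIter k H n h) = comulIter k H (n + 1) h := by
  induction n generalizing h with
  | zero => simp [comulLast, comulIter_zero]
  | succ n ih =>
    have : comulLast k H n ∘ₗ comulIter k H n = comulIter k H (n + 1) := LinearMap.ext ih
    rw [comulIter_succ k (n + 1), comulIter_succ k n, ← this, LinearMap.lTensor_comp]
    simp [comulLast]

lemma comulLast_tpow (n : ℕ) (f : Fin (n + 1) → H) :
    comulLast k H n (tpow k H n f) =
      ∑ p ∈ comulPairs k (f (Fin.last n)), tpow k H (n + 1) (splitLast n f p) := by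
  induction n with
  | zero =>
    have h : ∀ p : H × H, tpow k H 1 (splitLast 0 f p) =
        tpowCons k H 0 (p.1 ⊗ₜ tpowZero k H p.2) := fun p => rfl
    simp only [h, tpow_zero, comulLast, LinearMap.comp_apply, LinearEquiv.coe_coe,
      LinearEquiv.symm_apply_apply, comulIter_succ, comulIter_zero]
    rw [show Fin.last 0 = 0 from rfl, ← sum_comulPairs k (f 0)]
    simp
  | succ n ih =>
    have h : ∀ p : H × H, tpow k H (n + 2) (splitLast (n + 1) f p) =
        tpowCons k H (n + 1) (f 0 ⊗ₜ tpow k H (n + 1) (splitLast n (fun i => f i.succ) p)) := by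
      intro p
      rw [tpow_succ]
      congr 3
      ext j
      simp [splitLast]
    simp only [h, ← map_sum, ← TensorProduct.tmul_sum]
    rw [show Fin.last (n + 1) = (Fin.last n).succ from rfl, ← ih fun i => f i.succ]
    simp [tpow_succ, comulLast]

/-- Sweedler representations of `Δ⁽ⁿ⁺¹⁾` obtained by applying `Δ⁽ⁿ⁾` first and then `Δ` to the
last leg. -/
def backRepr : (n : ℕ) → (h : H) → IterRepr k H n h
  | 0, h => ⟨Unit, Finset.univ, fun _ _ => h, by simp [tpow_zero, comulIter_zero]⟩
  | n + 1, h =>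
    { ι := Σ _ : (backRepr n h).ι, H × H
      s := (backRepr n h).s.sigma fun i => comulPairs k ((backRepr n h).leg i (Fin.last n))
      leg := fun e => splitLast n ((backRepr n h).leg e.1) e.2
      eq := by
        rw [Finset.sum_sigma, ← comulLast_comulIter, ← (backRepr n h).eq, map_sum]
        simp only [comulLast_tpow] }

variable (H) in
/-- The diagonal coaction of `H` on its tensor powers. -/
def tpowCoact : (n : ℕ) → (Tpow k H n : Type) →ₗ[k] H ⊗[k] (Tpow k H n : Type)
  | 0 => LinearMap.lTensor H (tpowZero k H).toLinearMap ∘ₗ Coalgebra.comul ∘ₗ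
      (tpowZero k H).symm.toLinearMap
  | n + 1 => LinearMap.lTensor H (tpowCons k H n).toLinearMap ∘ₗ diagCoact (tpowCoact n) ∘ₗ
      (tpowCons k H n).symm.toLinearMap

variable (H) in
lemma isCoaction_tpowCoact (n : ℕ) : IsCoaction (tpowCoact k H n) := by
  induction n with
  | zero => exact IsCoaction.comul.congr _
  | succ n ih => exact ih.diag.congr _

variable {k} in
lemma diagCoact_tmul_of_sum {T I J : Type} [AddCommGroup T] [Module k T]
    {δ : T →ₗ[k] H ⊗[k] T} {h : H} {t : T} (s : Finset I) (l r : I → H)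
    (hs : ∑ i ∈ s, l i ⊗ₜ[k] r i = Coalgebra.comul (R := k) h)
    (s' : Finset J) (l' : J → H) (r' : J → T) (hs' : δ t = ∑ j ∈ s', l' j ⊗ₜ[k] r' j) :
    diagCoact δ (h ⊗ₜ t) = ∑ i ∈ s, ∑ j ∈ s', (l i * l' j) ⊗ₜ[k] (r i ⊗ₜ[k] r' j) := by
  simp [diagCoact, ← hs, hs', TensorProduct.sum_tmul, TensorProduct.tmul_sum]
  exact Finset.sum_comm

lemma tpowCoact_tpow (n : ℕ) (g : Fin (n + 1) → H) :
    tpowCoact k H n (tpow k H n g) =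
      ∑ u ∈ Fintype.piFinset (fun i => comulPairs k (g i)),
        (List.ofFn fun i => (u i).1).prod ⊗ₜ[k] tpow k H n (fun i => (u i).2) := by
  induction n with
  | zero =>
    simp only [sum_piFinset_succ, tpow_zero, tpowCoact, LinearMap.comp_apply, LinearEquiv.coe_coe,
      LinearEquiv.symm_apply_apply]
    rw [← sum_comulPairs k (g 0)]
    simp
  | succ n ih =>
    simp only [sum_piFinset_succ (n := n + 1), tpow_succ, tpowCoact, LinearMap.comp_apply,
      LinearEquiv.coe_coe, LinearEquiv.symm_apply_apply]
    rw [diagCoact_tmul_of_sum _ Prod.fst Prod.snd (sum_comulPairs k (g 0)) _ _ _ (ih _)]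
    simp [List.ofFn_succ]

end Sweedler

section PureTerms

variable {k : Type} [Field k] {H : Type} [Ring H] [HopfAlgebra k H]
variable {A : Type} [Ring A] [Algebra k A] (rho : H →ₗ[k] A →ₗ[k] A)

/-- The summand of `Ψ` for given Sweedler legs. -/
def psiTerm (n : ℕ) (x : ∀ i : Fin (n + 1), Fin ((i : ℕ) + 2) → H) (a : Fin (n + 1) → A) :
    (Tpow k (A ⊗[k] H) n : Type) :=
  tpow k (A ⊗[k] H) n (fun i =>
    (rho ((List.ofFn (fun m : Fin (n + 1 - (i : ℕ)) =>
        x ⟨(i : ℕ) + (m : ℕ), by have := m.isLt; have := i.isLt; omega⟩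
          ⟨(i : ℕ), by have := m.isLt; have := i.isLt; simp; omega⟩)).prod)
      (a i)) ⊗ₜ[k] x i (Fin.last ((i : ℕ) + 1)))

/-- The summand of `Φ` for given Sweedler legs. -/
def phiTerm (n : ℕ) (x : ∀ i : Fin (n + 1), Fin ((i : ℕ) + 2) → H) (a : Fin (n + 1) → A) :
    (Tpow k H n : Type) ⊗[k] (Tpow k A n : Type) :=
  tpow k H n (fun i => x i (Fin.last ((i : ℕ) + 1))) ⊗ₜ[k]
    tpow k A n (fun i =>
      rho (HopfAlgebra.antipode (R := k)
          ((List.ofFn (fun m : Fin (n + 1 - (i : ℕ)) =>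
            x ⟨(i : ℕ) + (m : ℕ), by have := m.isLt; have := i.isLt; omega⟩
              ⟨(m : ℕ), by have := m.isLt; have := i.isLt; simp; omega⟩)).prod))
        (a i))

lemma psiTerm_zero (x : ∀ i : Fin 1, Fin ((i : ℕ) + 2) → H) (a : Fin 1 → A) :
    psiTerm rho 0 x a = tpowZero k (A ⊗[k] H) (rho (x 0 0) (a 0) ⊗ₜ x 0 1) := by
  simp [psiTerm, tpow_zero]

lemma psiTerm_succ (n : ℕ) (x : ∀ i : Fin (n + 2), Fin ((i : ℕ) + 2) → H)
    (a : Fin (n + 2) → A) :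
    psiTerm rho (n + 1) x a = tpowCons k (A ⊗[k] H) n
      ((rho (x 0 0 * (List.ofFn fun j : Fin (n + 1) => x j.succ 0).prod) (a 0) ⊗ₜ x 0 1) ⊗ₜ
        psiTerm rho n (fun i j => x i.succ j.succ) (fun i => a i.succ)) := by
  rw [psiTerm, tpow_succ, psiTerm]
  congr 3
  · congr 3
    rw [← List.prod_cons, ← List.ofFn_cons]
    refine congrArg List.prod (ofFn_eq_ofFn rfl fun j hj hj' => ?_)
    cases j with
    | zero => exact leg_congr x rfl rfl
    | succ j => exact leg_congr x (Fin.ext (by simp)) rfl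
  · ext i
    congr 4
    refine ofFn_eq_ofFn (by simp) fun j hj hj' => ?_
    exact leg_congr x (Fin.ext (by simp; omega)) (by simp)

lemma phiTerm_zero (x : ∀ i : Fin 1, Fin ((i : ℕ) + 2) → H) (a : Fin 1 → A) :
    phiTerm rho 0 x a = tpowZero k H (x 0 1) ⊗ₜ
      tpowZero k A (rho (HopfAlgebra.antipode k (x 0 0)) (a 0)) := by
  simp [phiTerm, tpow_zero]

lemma phiTerm_succ (n : ℕ) (y : ∀ i : Fin (n + 2), Fin ((i : ℕ) + 2) → H)
    (x : ∀ i : Fin (n + 1), Fin ((i : ℕ) + 2) → H) (u : Fin (n + 1) → H × H)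
    (hy : ∀ i : Fin (n + 1), y i.succ = splitLast ((i : ℕ) + 1) (x i) (u i))
    (a : Fin (n + 2) → A) :
    phiTerm rho (n + 1) y a =
      tpowCons k H n (y 0 1 ⊗ₜ tpow k H n (fun i => (u i).2)) ⊗ₜ
      tpowCons k A n
        (rho (HopfAlgebra.antipode k (y 0 0 * (List.ofFn fun j => (u j).1).prod)) (a 0) ⊗ₜ
          tpow k A n (fun i =>
      rho (HopfAlgebra.antipode (R := k)
          ((List.ofFn (fun m : Fin (n + 1 - (i : ℕ)) =>
            x ⟨(i : ℕ) + (m : ℕ), by have := m.isLt; have := i.isLt; omega⟩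
              ⟨(m : ℕ), by have := m.isLt; have := i.isLt; simp; omega⟩)).prod))
        (a i.succ))) := by
  rw [phiTerm, tpow_succ, tpow_succ]
  congr 3
  · congr 2
    ext i
    rw [hy]
    simp [splitLast]
  · congr 4
    rw [← List.prod_cons, ← List.ofFn_cons]
    refine congrArg List.prod (ofFn_eq_ofFn rfl fun j hj hj' => ?_)
    cases j with
    | zero => exact leg_congr y rfl rfl
    | succ j =>
      have hj₀ : j < n + 1 := by simpa using hj
      calc
        _ = y (⟨j, hj₀⟩ : Fin (n + 1)).succ ⟨j + 1, by simp⟩ :=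
          leg_congr y (Fin.ext (by simp)) (by simp)
        _ = (u ⟨j, hj₀⟩).1 := by
          rw [hy]
          simp [splitLast]
        _ = _ := rfl
  · congr 1
    ext i
    congr 4
    refine ofFn_eq_ofFn (by simp) fun j hj hj' => ?_
    calc
      _ = y (⟨i + j, by omega⟩ : Fin (n + 1)).succ ⟨j, by simp; omega⟩ :=
        leg_congr y (Fin.ext (by simp; omega)) (by simp)
      _ = _ := by
        rw [hy]
        have : j < (i : ℕ) + j + 1 := by omega
        simp [splitLast, this]

end PureTerms

section Isomorphism

variable {k : Type} [Field k] {H : Type} [Ring H] [HopfAlgebra k H]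
variable {A : Type} [Ring A] [Algebra k A] {rho : H →ₗ[k] A →ₗ[k] A}

lemma lift_rho_antipode (hco : Cocomm k H) (hma : IsModuleAlgebraAction k H A rho) (a : A) (h : H) :
    TensorProduct.lift (rho.flip ∘ₗ (rho ∘ₗ HopfAlgebra.antipode k).flip a)
      (Coalgebra.comul (R := k) h) = Coalgebra.counit (R := k) h • a := by
  have h₁ : ∀ z : H ⊗[k] H,
      TensorProduct.lift (rho.flip ∘ₗ (rho ∘ₗ HopfAlgebra.antipode k).flip a) z =
        rho (LinearMap.mul' k H (LinearMap.lTensor H (HopfAlgebra.antipode k)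
          (TensorProduct.comm k H H z))) a := by
    intro z
    induction z with
    | zero => simp
    | add x y hx hy => simp only [map_add, hx, hy, LinearMap.add_apply]
    | tmul h t => simp [hma.2]
  rw [h₁, hco, HopfAlgebra.mul_antipode_lTensor_comul_apply, Algebra.algebraMap_eq_smul_one,
    map_smul, LinearMap.smul_apply, hma.1.2.2]

lemma lift_antipode_rho (hco : Cocomm k H) (hma : IsModuleAlgebraAction k H A rho) (a : A) (h : H) :
    TensorProduct.lift ((rho ∘ₗ HopfAlgebra.antipode k).flip ∘ₗ rho.flip a)
      (Coalgebra.comul (R := k) h) = Coalgebra.counit (R := k) h • a := by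
  have h₁ : ∀ z : H ⊗[k] H,
      TensorProduct.lift ((rho ∘ₗ HopfAlgebra.antipode k).flip ∘ₗ rho.flip a) z =
        rho (LinearMap.mul' k H (LinearMap.rTensor H (HopfAlgebra.antipode k)
          (TensorProduct.comm k H H z))) a := by
    intro z
    induction z with
    | zero => simp
    | add x y hx hy => simp only [map_add, hx, hy, LinearMap.add_apply]
    | tmul h t => simp [hma.2]
  rw [h₁, hco, HopfAlgebra.mul_antipode_rTensor_comul_apply, Algebra.algebraMap_eq_smul_one,
    map_smul, LinearMap.smul_apply, hma.1.2.2]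

/-- The twist of a left `H`-comodule by the action on `A`. -/
def actionTwist (hco : Cocomm k H) (hma : IsModuleAlgebraAction k H A rho)
    {T : Type} [AddCommGroup T] [Module k T] {δ : T →ₗ[k] H ⊗[k] T} (hδ : IsCoaction δ) :
    (T ⊗[k] A) ≃ₗ[k] (T ⊗[k] A) :=
  twistEquiv hδ (lift_rho_antipode hco hma) (lift_antipode_rho hco hma)

section

variable (hco : Cocomm k H) (hma : IsModuleAlgebraAction k H A rho)
variable {T : Type} [AddCommGroup T] [Module k T] {δ : T →ₗ[k] H ⊗[k] T} (hδ : IsCoaction δ)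

lemma actionTwist_tmul (t : T) (a : A) :
    actionTwist hco hma hδ (t ⊗ₜ a) = twistAux T rho a (δ t) :=
  twist_tmul _ _ _ _

lemma actionTwist_symm_tmul (t : T) (a : A) :
    (actionTwist hco hma hδ).symm (t ⊗ₜ a) =
      twistAux T (rho ∘ₗ HopfAlgebra.antipode k) a (δ t) :=
  twist_tmul _ _ _ _

end

/-- The rearrangement `((h ⊗ t) ⊗ a) ⊗ b ↦ (a ⊗ h) ⊗ (t ⊗ b)`. -/
def rearrange (k H A T B : Type) [Field k] [AddCommGroup H] [Module k H] [AddCommGroup A]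
    [Module k A] [AddCommGroup T] [Module k T] [AddCommGroup B] [Module k B] :
    (((H ⊗[k] T) ⊗[k] A) ⊗[k] B) ≃ₗ[k] ((A ⊗[k] H) ⊗[k] (T ⊗[k] B)) :=
  (TensorProduct.comm k (H ⊗[k] T) A ≪≫ₗ (TensorProduct.assoc k A H T).symm).rTensor B ≪≫ₗ
    TensorProduct.assoc k (A ⊗[k] H) T B

section

variable {X A T B : Type} [AddCommGroup X] [Module k X] [AddCommGroup A]
    [Module k A] [AddCommGroup T] [Module k T] [AddCommGroup B] [Module k B]

lemma rearrange_tmul (h : X) (t : T) (a : A) (b : B) :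
    rearrange k X A T B (((h ⊗ₜ t) ⊗ₜ a) ⊗ₜ b) = (a ⊗ₜ h) ⊗ₜ (t ⊗ₜ b) := by
  simp [rearrange]

lemma rearrange_symm_tmul (h : X) (t : T) (a : A) (b : B) :
    (rearrange k X A T B).symm ((a ⊗ₜ h) ⊗ₜ (t ⊗ₜ b)) = ((h ⊗ₜ t) ⊗ₜ a) ⊗ₜ b := by
  rw [LinearEquiv.symm_apply_eq, rearrange_tmul]

end

/-- The isomorphism `Ψ`, with inverse `Φ`. -/
def psiEquiv (hco : Cocomm k H) (hma : IsModuleAlgebraAction k H A rho) : (n : ℕ) →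
    ((Tpow k H n : Type) ⊗[k] (Tpow k A n : Type)) ≃ₗ[k] (Tpow k (A ⊗[k] H) n : Type)
  | 0 => TensorProduct.congr (tpowZero k H).symm (tpowZero k A).symm ≪≫ₗ
      actionTwist hco hma IsCoaction.comul ≪≫ₗ TensorProduct.comm k H A ≪≫ₗ
      tpowZero k (A ⊗[k] H)
  | n + 1 => TensorProduct.congr (tpowCons k H n).symm (tpowCons k A n).symm ≪≫ₗ
      (TensorProduct.assoc k (H ⊗[k] (Tpow k H n : Type)) A (Tpow k A n : Type)).symm ≪≫ₗ
      (actionTwist hco hma (isCoaction_tpowCoact k H n).diag).rTensor (Tpow k A n : Type) ≪≫ₗ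
      rearrange k H A (Tpow k H n : Type) (Tpow k A n : Type) ≪≫ₗ
      (psiEquiv hco hma n).lTensor (A ⊗[k] H) ≪≫ₗ
      tpowCons k (A ⊗[k] H) n

variable (hco : Cocomm k H) (hma : IsModuleAlgebraAction k H A rho)

lemma psiEquiv_tmul (n : ℕ) (g : Fin (n + 1) → H) (a : Fin (n + 1) → A) :
    psiEquiv hco hma n (tpow k H n g ⊗ₜ tpow k A n a) =
      ∑ e ∈ Fintype.piFinset (fun i : Fin (n + 1) => (frontRepr k ((i : ℕ) + 1) (g i)).s),
        psiTerm rho n (fun i => (frontRepr k ((i : ℕ) + 1) (g i)).leg (e i)) a := by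
  induction n with
  | zero =>
    simp only [sum_piFinset_succ, psiTerm_zero, Fin.cons_zero, tpow_zero, psiEquiv,
      LinearEquiv.trans_apply, TensorProduct.congr_tmul, LinearEquiv.symm_apply_apply,
      actionTwist_tmul]
    rw [← (frontRepr k 1 (g 0)).sum_pair]
    simp
  | succ n ih =>
    simp only [psiEquiv, tpow_succ, LinearEquiv.trans_apply, TensorProduct.congr_tmul,
      LinearEquiv.symm_apply_apply, TensorProduct.assoc_symm_tmul, LinearEquiv.rTensor_tmul,
      actionTwist_tmul]
    rw [diagCoact_tmul_of_sum _ _ _ (frontRepr k 1 (g 0)).sum_pair _ _ _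
      (tpowCoact_tpow k n fun i : Fin (n + 1) => g i.succ)]
    simp only [map_sum, twistAux_tmul, TensorProduct.sum_tmul, rearrange_tmul,
      LinearEquiv.lTensor_tmul, ih, TensorProduct.tmul_sum]
    rw [sum_piFinset_succ (n := n + 1)]
    refine Finset.sum_congr rfl fun p _ => ?_
    refine Eq.trans ?_ (sum_piFinset_sigma (fun i : Fin (n + 1) => comulPairs k (g i.succ))
      (fun i q => (frontRepr k ((i : ℕ) + 1) q.2).s) _).symm
    refine Finset.sum_congr rfl fun u _ => Finset.sum_congr rfl fun v _ => ?_
    rw [psiTerm_succ]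
    rfl

lemma psiEquiv_symm_tpow (n : ℕ) (g : Fin (n + 1) → H) (a : Fin (n + 1) → A) :
    (psiEquiv hco hma n).symm (tpow k (A ⊗[k] H) n fun i => a i ⊗ₜ g i) =
      ∑ e ∈ Fintype.piFinset (fun i : Fin (n + 1) => (backRepr k ((i : ℕ) + 1) (g i)).s),
        phiTerm rho n (fun i => (backRepr k ((i : ℕ) + 1) (g i)).leg (e i)) a := by
  induction n with
  | zero =>
    simp only [sum_piFinset_succ, phiTerm_zero, Fin.cons_zero, tpow_zero, psiEquiv,
      LinearEquiv.trans_symm, LinearEquiv.trans_apply, LinearEquiv.symm_apply_apply,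
      TensorProduct.comm_symm_tmul, actionTwist_symm_tmul]
    rw [← (backRepr k 1 (g 0)).sum_pair]
    simp [TensorProduct.congr_symm_tmul]
  | succ n ih =>
    rw [sum_piFinset_succ (n := n + 1)]
    refine Eq.trans ?_ (Finset.sum_congr rfl fun p _ =>
      sum_piFinset_sigma (fun i : Fin (n + 1) => (backRepr k ((i : ℕ) + 1) (g i.succ)).s)
        (fun i q => comulPairs k
          ((backRepr k ((i : ℕ) + 1) (g i.succ)).leg q (Fin.last ((i : ℕ) + 1)))) _).symm
    rw [Finset.sum_comm]
    conv_lhs =>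
      simp only [psiEquiv, tpow_succ, LinearEquiv.trans_symm, LinearEquiv.trans_apply,
        LinearEquiv.symm_apply_apply, LinearEquiv.symm_lTensor, LinearEquiv.lTensor_tmul, ih,
        TensorProduct.tmul_sum, map_sum]
    refine Finset.sum_congr rfl fun e _ => ?_
    rw [phiTerm, rearrange_symm_tmul, LinearEquiv.symm_rTensor, LinearEquiv.rTensor_tmul,
      actionTwist_symm_tmul, diagCoact_tmul_of_sum _ _ _ (backRepr k 1 (g 0)).sum_pair _ _ _
      (tpowCoact_tpow k n _)]
    simp only [map_sum, twistAux_tmul, TensorProduct.sum_tmul]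
    refine Finset.sum_congr rfl fun p _ => Finset.sum_congr rfl fun u _ => ?_
    rw [phiTerm_succ rho n _ (fun i => (backRepr k ((i : ℕ) + 1) (g i.succ)).leg (e i)) u
      fun i => rfl]
    simp [TensorProduct.congr_symm_tmul]
    rfl

end Isomorphism

/-- Under the standing assumptions, the maps
`Φ : (A #_σ H)^{⊗(n+1)} → H^{⊗(n+1)} ⊗ A^{⊗(n+1)}` and
`Ψ : H^{⊗(n+1)} ⊗ A^{⊗(n+1)} → (A #_σ H)^{⊗(n+1)}` are mutually inverse. -/
theorem phi_psi_inverse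
    (k : Type) [Field k] (H : Type) [Ring H] [HopfAlgebra k H]
    (A : Type) [Ring A] [Algebra k A]
    (rho : H →ₗ[k] A →ₗ[k] A) (sg : H →ₗ[k] H →ₗ[k] k)
    (hco : Cocomm k H) (hma : IsModuleAlgebraAction k H A rho)
    (hnorm : NormalKA k H A sg) (hcoc : CocycleKA k H A sg)
    (htw : TwistedModuleK k H A rho sg) (hinv : ConvInvertibleK k H A sg)
    (n : ℕ)
    (Phi : (Tpow k (A ⊗[k] H) n : Type) →ₗ[k]
      ((Tpow k H n : Type) ⊗[k] (Tpow k A n : Type)))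
    (Psi : ((Tpow k H n : Type) ⊗[k] (Tpow k A n : Type)) →ₗ[k]
      (Tpow k (A ⊗[k] H) n : Type))
    (hPhi : IsPhi k H A rho n Phi)
    (hPsi : IsPsi k H A rho n Psi) :
    Psi ∘ₗ Phi = LinearMap.id ∧ Phi ∘ₗ Psi = LinearMap.id := by
  have hΦ : Phi = (psiEquiv hco hma n).symm.toLinearMap := by
    refine Tpow.linearMap_ext (TensorProduct.span_tmul_eq_top k A H) n fun f hf => ?_
    choose a g hag using hf
    obtain rfl : (fun i => a i ⊗ₜ[k] g i) = f := funext hag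
    exact (hPhi a g fun i => backRepr k ((i : ℕ) + 1) (g i)).trans
      (psiEquiv_symm_tpow hco hma n g a).symm
  have hΨ : Psi = (psiEquiv hco hma n).toLinearMap := by
    refine TensorProduct.ext (Tpow.linearMap_ext Submodule.span_univ n fun g _ =>
      Tpow.linearMap_ext Submodule.span_univ n fun a _ => ?_)
    exact (hPsi g a fun i => frontRepr k ((i : ℕ) + 1) (g i)).trans
      (psiEquiv_tmul hco hma n g a).symm
  rw [hΦ, hΨ]
  exact ⟨(psiEquiv hco hma n).comp_symm, (psiEquiv hco hma n).symm_comp⟩
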